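/- arXiv:1802.01658 — 2 statements merged into one kernel-verified Lean document; each statement's English description precedes it below -/
import Mathlib

section
/- Let p be a prime, let λ be a p-cycle in the symmetric group on Fin p (a cyclic permutation whose support is all of Fin p), let r be a natural number whose residue modulo p is a unit of multiplicative order p − 1 in (ℤ/pℤ)ˣ, and let μ be a permutation of Fin p with μ * λ * μ⁻¹ = λ ^ r. Then for every integer m not divisible by p and every natural number n not divisible by p − 1, the commutator λ ^ m * μ ^ n * λ ^ (−m) * μ ^ (−n) is a p-cycle, i.e., a cyclic permutation whose support is all of Fin p. -/
/-- A nontrivial permutation of `Fin p` whose order divides the prime `p` is a `p`-cycle. -/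
theorem Equiv.Perm.isCycle_and_support_eq_univ_of_pow_prime_eq_one {p : ℕ} (hp : p.Prime)
    {g : Equiv.Perm (Fin p)} (hg : g ^ p = 1) (hg1 : g ≠ 1) :
    g.IsCycle ∧ g.support = Finset.univ := by
  have := Fact.mk hp
  have ho : orderOf g = p := orderOf_eq_prime hg hg1
  have hc : g.IsCycle :=
    Equiv.Perm.isCycle_of_prime_order'' (by simpa using hp) (by simpa using ho)
  refine ⟨hc, Finset.card_eq_iff_eq_univ _ |>.mp ?_⟩
  rw [← hc.orderOf, ho, Fintype.card_fin]

/-- If `b` conjugates `a` to `a ^ r`, then `b ^ n` conjugates `a` to `a ^ r ^ n`. -/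
theorem pow_mul_mul_inv_pow_eq_pow_pow {G : Type*} [Group G] {a b : G} {r : ℕ}
    (h : b * a * b⁻¹ = a ^ r) (n : ℕ) : b ^ n * a * (b ^ n)⁻¹ = a ^ r ^ n := by
  induction n with
  | zero => simp
  | succ k ih =>
    calc b ^ (k + 1) * a * (b ^ (k + 1))⁻¹
        = b ^ k * (b * a * b⁻¹) * (b ^ k)⁻¹ := by group
      _ = a ^ r ^ (k + 1) := by
        rw [h, ← conj_pow, ih, ← pow_mul, pow_succ]

/-- If `b` conjugates `a` to `a ^ r`, then `[a ^ m, b ^ n] = a ^ (m * (1 - r ^ n))`. -/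
theorem zpow_pow_commutator_eq {G : Type*} [Group G] {a b : G} {r : ℕ}
    (h : b * a * b⁻¹ = a ^ r) (m : ℤ) (n : ℕ) :
    a ^ m * b ^ n * a ^ (-m) * b ^ (-(n : ℤ)) = a ^ (m * (1 - (r : ℤ) ^ n)) := by
  have h1 : b ^ n * a ^ (-m) * (b ^ n)⁻¹ = a ^ ((r : ℤ) ^ n * -m) := by
    rw [← conj_zpow, pow_mul_mul_inv_pow_eq_pow_pow h, ← zpow_natCast, ← zpow_mul]
    push_cast
    rfl
  rw [zpow_neg b, zpow_natCast, mul_assoc (a ^ m), mul_assoc (a ^ m), h1, ← zpow_add]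
  congr 1
  ring

/-- Let `λ` be a `p`-cycle in the symmetric group on `Fin p`, `r` a natural number whose
residue mod `p` is a unit of multiplicative order `p - 1`, and `μ` a permutation with
`μ * λ * μ⁻¹ = λ ^ r`. Then for every integer `m` not divisible by `p` and every natural
number `n` not divisible by `p - 1`, the commutator `λ ^ m * μ ^ n * λ ^ (-m) * μ ^ (-n)`
is a `p`-cycle. -/
theorem stmt_3 (p : ℕ) (hp : p.Prime) (lam : Equiv.Perm (Fin p))
    (hc : lam.IsCycle) (hs : lam.support = Finset.univ)
    (r : ℕ) (hr : ∃ u : (ZMod p)ˣ, (u : ZMod p) = (r : ZMod p) ∧ orderOf u = p - 1)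
    (mu : Equiv.Perm (Fin p)) (hmu : mu * lam * mu⁻¹ = lam ^ r)
    (m : ℤ) (hm : ¬ (p : ℤ) ∣ m) (n : ℕ) (hn : ¬ (p - 1) ∣ n) :
    (lam ^ m * mu ^ n * lam ^ (-m) * mu ^ (-(n : ℤ))).IsCycle ∧
    (lam ^ m * mu ^ n * lam ^ (-m) * mu ^ (-(n : ℤ))).support = Finset.univ := by
  have ho : orderOf lam = p := by rw [hc.orderOf, hs, Finset.card_univ, Fintype.card_fin]
  rw [zpow_pow_commutator_eq hmu]
  apply Equiv.Perm.isCycle_and_support_eq_univ_of_pow_prime_eq_one hp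
  · rw [← zpow_natCast, ← zpow_mul, ← orderOf_dvd_iff_zpow_eq_one, ho]
    exact dvd_mul_left _ _
  · rw [Ne, ← orderOf_dvd_iff_zpow_eq_one, ho]
    intro hdvd
    obtain ⟨u, hu, hou⟩ := hr
    refine hn ?_
    rw [← hou, orderOf_dvd_iff_pow_eq_one]
    have h0 := ((Nat.prime_iff_prime_int.mp hp).dvd_or_dvd hdvd).resolve_left hm
    rw [← ZMod.intCast_zmod_eq_zero_iff_dvd] at h0
    push_cast at h0
    ext
    rw [Units.val_pow_eq_pow_val, hu, Units.val_one]
    exact (sub_eq_zero.mp h0).symm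
end

section
/- Let p be a prime, let λ be a p-cycle in the symmetric group on Fin p, let r be a natural number whose residue modulo p is a unit of multiplicative order p − 1 in (ℤ/pℤ)ˣ, and let μ be a permutation of Fin p with μ * λ * μ⁻¹ = λ ^ r. Then for every integer m not divisible by p and every natural number n not divisible by p − 1, the cyclic subgroup generated by the commutator λ ^ m * μ ^ n * λ ^ (−m) * μ ^ (−n) acts transitively on Fin p: for all x, y in Fin p there is an integer k with the k-th power of this commutator sending x to y. -/
/-- If `a` conjugates `b` to `b ^ r`, then `a ^ n` conjugates `b ^ j` to `b ^ (r ^ n * j)`. -/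
theorem pow_mul_zpow_mul_inv_pow_of_conj_eq_pow {G : Type*} [Group G] {a b : G} {r : ℕ}
    (h : a * b * a⁻¹ = b ^ r) (n : ℕ) (j : ℤ) :
    a ^ n * b ^ j * (a ^ n)⁻¹ = b ^ ((r : ℤ) ^ n * j) := by
  induction n generalizing j with
  | zero => simp
  | succ n ih =>
    have hj : a * b ^ j * a⁻¹ = b ^ ((r : ℤ) * j) := by
      rw [← conj_zpow, h, zpow_mul, zpow_natCast]
    calc a ^ (n + 1) * b ^ j * (a ^ (n + 1))⁻¹
        = a ^ n * (a * b ^ j * a⁻¹) * (a ^ n)⁻¹ := by rw [pow_succ]; group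
      _ = b ^ ((r : ℤ) ^ (n + 1) * j) := by rw [hj, ih, pow_succ, mul_assoc]

/-- A power of a full cycle, with exponent coprime to its order, acts transitively. -/
theorem Equiv.Perm.IsCycle.exists_zpow_zpow_apply_eq {α : Type*} [Fintype α] [DecidableEq α]
    {f : Equiv.Perm α} (hf : f.IsCycle) (hs : f.support = Finset.univ) {e : ℤ}
    (he : IsCoprime e (orderOf f : ℤ)) (x y : α) : ∃ k : ℤ, ((f ^ e) ^ k) x = y := by
  have hmem (z : α) : f z ≠ z := by
    rw [← Equiv.Perm.mem_support, hs]
    exact Finset.mem_univ z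
  obtain ⟨i, hi⟩ := hf.sameCycle (hmem x) (hmem y)
  obtain ⟨a, b, hab⟩ := he
  refine ⟨a * i, ?_⟩
  have hfe : (f ^ e) ^ (a * i) = f ^ i := by
    have hexp : e * (a * i) = i + (orderOf f : ℤ) * (-(b * i)) := by
      linear_combination i * hab
    rw [← zpow_mul, hexp, zpow_add, zpow_mul f (orderOf f : ℤ), zpow_natCast, pow_orderOf_eq_one,
      one_zpow, mul_one]
  rw [hfe, hi]


/-- With `λ` a `p`-cycle, `r` a natural number whose residue mod `p` is a unit of
multiplicative order `p - 1`, and `μ` conjugating `λ` to `λ ^ r`, the cyclic subgroup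
generated by the commutator `λ ^ m * μ ^ n * λ ^ (-m) * μ ^ (-n)` acts transitively on
`Fin p`, for every integer `m` not divisible by `p` and natural number `n` not divisible
by `p - 1`. -/
theorem stmt_5 (p : ℕ) (hp : p.Prime) (lam : Equiv.Perm (Fin p))
    (hc : lam.IsCycle) (hs : lam.support = Finset.univ)
    (r : ℕ) (hr : ∃ u : (ZMod p)ˣ, (u : ZMod p) = (r : ZMod p) ∧ orderOf u = p - 1)
    (mu : Equiv.Perm (Fin p)) (hmu : mu * lam * mu⁻¹ = lam ^ r)
    (m : ℤ) (hm : ¬ (p : ℤ) ∣ m) (n : ℕ) (hn : ¬ (p - 1) ∣ n) :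
    ∀ x y : Fin p, ∃ k : ℤ,
      ((lam ^ m * mu ^ n * lam ^ (-m) * mu ^ (-(n : ℤ))) ^ k) x = y := by
  obtain ⟨u, hu, huo⟩ := hr
  have hcomm : lam ^ m * mu ^ n * lam ^ (-m) * mu ^ (-(n : ℤ)) =
      lam ^ (m * (1 - (r : ℤ) ^ n)) := by
    rw [zpow_neg mu, zpow_natCast, mul_assoc (lam ^ m), mul_assoc (lam ^ m),
      pow_mul_zpow_mul_inv_pow_of_conj_eq_pow hmu, ← zpow_add]
    congr 1
    ring
  have hr1 : ¬ (p : ℤ) ∣ 1 - (r : ℤ) ^ n := by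
    intro hdvd
    rw [← ZMod.intCast_zmod_eq_zero_iff_dvd] at hdvd
    push_cast at hdvd
    rw [← hu, sub_eq_zero] at hdvd
    refine hn (huo ▸ orderOf_dvd_of_pow_eq_one (Units.ext ?_))
    rw [Units.val_pow_eq_pow_val, ← hdvd, Units.val_one]
  have hpZ : Prime (p : ℤ) := Nat.prime_iff_prime_int.mp hp
  have hord : orderOf lam = p := by
    rw [hc.orderOf, hs, Finset.card_univ, Fintype.card_fin]
  have hcop : IsCoprime (m * (1 - (r : ℤ) ^ n)) (orderOf lam : ℤ) := by
    rw [hord]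
    refine ((Prime.coprime_iff_not_dvd hpZ).mpr fun h => ?_).symm
    exact (hpZ.dvd_or_dvd h).elim hm hr1
  intro x y
  rw [hcomm]
  exact hc.exists_zpow_zpow_apply_eq hs hcop x y
end
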